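/- Let C⊥ ⊆ F₂²³ be the binary Golay code specified in the context, and for a coset u + C⊥ of C⊥ in F₂²³ let its minimal weight be the minimum Hamming weight of its elements. Then every coset of C⊥ contains exactly one vector of Hamming weight at most 3, and the number of cosets of C⊥ with minimal weight w, for w = 0, 1, 2, 3, is respectively 1, 23, 253, 1771 (= C(23,w)); no coset has minimal weight greater than 3. -/

import Mathlib

def golaySupports : Fin 11 → Finset (Fin 23) :=
  ![{1,4,7,8,9,10,11,22}, {0,3,6,7,8,9,10,21}, {1,2,4,5,6,10,11,20},
    {0,1,3,4,5,9,10,19}, {0,1,2,3,7,10,11,18}, {0,2,4,6,7,8,11,17},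
    {3,4,5,6,8,9,11,16}, {2,3,4,5,7,8,10,15}, {1,2,3,4,6,7,9,14},
    {0,1,2,3,5,6,8,13}, {0,2,5,8,9,10,11,12}]

def golayGen (i : Fin 11) : Fin 23 → ZMod 2 := fun j => if j ∈ golaySupports i then 1 else 0

def golayC : Submodule (ZMod 2) (Fin 23 → ZMod 2) :=
  Submodule.span (ZMod 2) (Set.range golayGen)

def golayDual : Submodule (ZMod 2) (Fin 23 → ZMod 2) where
  carrier := {u | ∀ w ∈ golayC, ∑ i, u i * w i = 0}
  zero_mem' := by intro w _; simp
  add_mem' := by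
    intro u v hu hv w hw
    simp only [Set.mem_setOf_eq] at hu hv ⊢
    simp only [Pi.add_apply, add_mul, Finset.sum_add_distrib, hu w hw, hv w hw, add_zero]
  smul_mem' := by
    intro c u hu w hw
    simp only [Set.mem_setOf_eq] at hu ⊢
    simp only [Pi.smul_apply, smul_eq_mul, mul_assoc, ← Finset.mul_sum, hu w hw, mul_zero]

/-- The minimal Hamming weight among representatives of a coset of `golayDual`. -/
noncomputable def minWtDual (q : (Fin 23 → ZMod 2) ⧸ golayDual) : ℕ :=
  sInf {n | ∃ v : Fin 23 → ZMod 2,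
    (Submodule.Quotient.mk v : (Fin 23 → ZMod 2) ⧸ golayDual) = q ∧ hammingNorm v = n}

/-- The syndrome of a vector: its dot products with the generators of `golayC`. -/
def golaySyndrome : (Fin 23 → ZMod 2) →ₗ[ZMod 2] (Fin 11 → ZMod 2) where
  toFun u i := u ⬝ᵥ golayGen i
  map_add' u v := by ext i; simp [add_dotProduct]
  map_smul' c u := by ext i; simp [smul_dotProduct]

theorem mem_golayDual_iff {u : Fin 23 → ZMod 2} : u ∈ golayDual ↔ golaySyndrome u = 0 := by
  constructor
  · intro h
    ext i
    exact h _ (Submodule.subset_span ⟨i, rfl⟩)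
  · intro h w hw
    change u ⬝ᵥ w = 0
    induction hw using Submodule.span_induction with
    | mem x hx =>
      obtain ⟨i, rfl⟩ := hx
      exact congrFun h i
    | zero => simp
    | add x y _ _ hx hy => rw [dotProduct_add, hx, hy, add_zero]
    | smul c x _ hx => rw [dotProduct_smul, hx, smul_zero]

theorem mk_golayDual_eq_iff {u v : Fin 23 → ZMod 2} :
    (Submodule.Quotient.mk u : (Fin 23 → ZMod 2) ⧸ golayDual) = Submodule.Quotient.mk v ↔
      golaySyndrome u = golaySyndrome v := by
  rw [Submodule.Quotient.eq, mem_golayDual_iff, map_sub, sub_eq_zero]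

/-- The binary digits of a natural number, as a vector over `ZMod 2`. -/
def bitVector (k n : ℕ) : Fin k → ZMod 2 := fun i => if n.testBit i then 1 else 0

theorem bitVector_xor (k a b : ℕ) : bitVector k (a ^^^ b) = bitVector k a + bitVector k b := by
  ext i
  simp only [bitVector, Nat.testBit_xor, Pi.add_apply]
  cases a.testBit i <;> cases b.testBit i <;> decide

theorem exists_bitVector_eq {k : ℕ} (s : Fin k → ZMod 2) : ∃ n < 2 ^ k, bitVector k n = s := by
  refine ⟨Nat.ofBits fun i => decide (s i = 1), Nat.ofBits_lt_two_pow _, ?_⟩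
  ext i
  simp only [bitVector, Nat.testBit_ofBits_lt _ _ i.2, decide_eq_true_eq, Fin.eta]
  generalize s i = x
  revert x
  decide

/-- The columns of the generator matrix of `golayC`, each encoded as a natural number. -/
def golayColumns : List ℕ :=
  [1594, 797, 1972, 986, 493, 1740, 870, 435, 1763, 1355, 1183, 1141,
    1024, 512, 256, 128, 64, 32, 16, 8, 4, 2, 1]

theorem golaySyndrome_single (j : Fin 23) :
    golaySyndrome (Pi.single j 1) = bitVector 11 (golayColumns.get j) := by
  ext i
  change Pi.single j 1 ⬝ᵥ golayGen i = _
  rw [single_one_dotProduct]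
  revert i j
  decide +kernel

theorem testBit_foldr_lor {α : Type*} (f : α → ℕ) (l : List α) (k : ℕ) :
    (l.foldr (fun c m => f c ||| m) 0).testBit k = true ↔ ∃ c ∈ l, (f c).testBit k = true := by
  induction l with
  | nil => simp
  | cons a l ih => simp [ih]

theorem exists_xor_golayColumns {n : ℕ} (hn : n < 2 ^ 11) :
    ∃ a ∈ 0 :: golayColumns, ∃ b ∈ 0 :: golayColumns, ∃ c ∈ 0 :: golayColumns,
      a ^^^ b ^^^ c = n := by
  have key : (0 :: golayColumns).foldr (fun a m => (0 :: golayColumns).foldr (fun b m =>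
      (0 :: golayColumns).foldr (fun c m => 2 ^ (a ^^^ b ^^^ c) ||| m) 0 ||| m) 0 ||| m) 0 =
      2 ^ 2 ^ 11 - 1 := by
    decide +kernel
  have h := congrArg (fun m => m.testBit n) key
  simpa only [Nat.testBit_two_pow_sub_one, hn, decide_true, testBit_foldr_lor,
    Nat.testBit_two_pow, decide_eq_true_eq] using h

theorem hammingNorm_single_le_one {ι : Type*} [Fintype ι] [DecidableEq ι] {β : Type*}
    [DecidableEq β] [Zero β] (j : ι) (x : β) : hammingNorm (Pi.single j x : ι → β) ≤ 1 := by
  refine (Finset.card_le_card (t := {j}) fun i hi => ?_).trans_eq (Finset.card_singleton j)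
  by_contra h
  rw [Finset.mem_singleton] at h
  simp [Pi.single_eq_of_ne h] at hi

theorem exists_hammingNorm_le_one {a : ℕ} (ha : a ∈ 0 :: golayColumns) :
    ∃ v, hammingNorm v ≤ 1 ∧ golaySyndrome v = bitVector 11 a := by
  rcases List.mem_cons.1 ha with rfl | ha
  · refine ⟨0, by simp, ?_⟩
    ext i
    simp [bitVector]
  · obtain ⟨j, rfl⟩ := List.get_of_mem ha
    exact ⟨Pi.single j 1, hammingNorm_single_le_one (ι := Fin 23) j 1, golaySyndrome_single j⟩

theorem hammingNorm_add_le {ι : Type*} [Fintype ι] {β : ι → Type*} [∀ i, DecidableEq (β i)]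
    [∀ i, AddGroup (β i)] (x y : ∀ i, β i) :
    hammingNorm (x + y) ≤ hammingNorm x + hammingNorm y := by
  classical
  refine (Finset.card_le_card fun i hi => ?_).trans (Finset.card_union_le _ _)
  simp only [Finset.mem_filter, Finset.mem_union, Finset.mem_univ, true_and, Pi.add_apply] at hi ⊢
  by_contra! h
  simp [h.1, h.2] at hi

theorem exists_hammingNorm_le_three (s : Fin 11 → ZMod 2) :
    ∃ v, hammingNorm v ≤ 3 ∧ golaySyndrome v = s := by
  obtain ⟨n, hn, rfl⟩ := exists_bitVector_eq s
  obtain ⟨a, ha, b, hb, c, hc, rfl⟩ := exists_xor_golayColumns hn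
  obtain ⟨x, hx, hxa⟩ := exists_hammingNorm_le_one ha
  obtain ⟨y, hy, hyb⟩ := exists_hammingNorm_le_one hb
  obtain ⟨z, hz, hzc⟩ := exists_hammingNorm_le_one hc
  refine ⟨x + y + z, ?_, by simp only [map_add, bitVector_xor, hxa, hyb, hzc]⟩
  have h₁ := hammingNorm_add_le (x + y) z
  have h₂ := hammingNorm_add_le x y
  lia

theorem card_hammingNorm_eq (ι : Type*) [Fintype ι] [DecidableEq ι] (w : ℕ) :
    (Finset.univ.filter fun v : ι → ZMod 2 => hammingNorm v = w).card =
      (Fintype.card ι).choose w := by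
  rw [← Finset.card_univ, ← Finset.card_powersetCard]
  refine Finset.card_bij' (fun v _ => Finset.univ.filter fun i => v i ≠ 0)
    (fun s _ i => if i ∈ s then 1 else 0) ?_ ?_ ?_ ?_
  · intro v hv
    simpa [Finset.mem_powersetCard, hammingNorm] using hv
  · intro s hs
    simpa [Finset.mem_powersetCard, hammingNorm] using hs
  · intro v _
    ext i
    simp only [Finset.mem_filter, Finset.mem_univ, true_and]
    generalize v i = x
    revert x
    decide
  · intro s _
    ext i
    simp

theorem card_hammingNorm_le_three :
    (Finset.univ.filter fun v : Fin 23 → ZMod 2 => hammingNorm v ≤ 3).card = 2 ^ 11 := by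
  rw [Finset.card_eq_sum_card_fiberwise (f := hammingNorm) (t := Finset.range 4)
    (fun v hv => by simpa [Nat.lt_succ_iff] using hv)]
  calc _ = ∑ w ∈ Finset.range 4, Nat.choose 23 w := by
        refine Finset.sum_congr rfl fun w hw => ?_
        rw [Finset.filter_filter]
        refine Eq.trans ?_ ((card_hammingNorm_eq (Fin 23) w).trans (by rw [Fintype.card_fin]))
        congr 1
        ext v
        have := Finset.mem_range.1 hw
        simp only [Finset.mem_filter, Finset.mem_univ, true_and]
        lia
    _ = 2 ^ 11 := by decide

theorem golaySyndrome_injOn :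
    Set.InjOn golaySyndrome {v | hammingNorm v ≤ 3} := by
  have h := Finset.injOn_of_surjOn_of_card_le
    (s := Finset.univ.filter fun v : Fin 23 → ZMod 2 => hammingNorm v ≤ 3)
    (t := (Finset.univ : Finset (Fin 11 → ZMod 2))) golaySyndrome (fun _ _ => by simp)
    (fun s _ => by simpa using exists_hammingNorm_le_three s)
    (by simp [card_hammingNorm_le_three])
  simpa using h

theorem minWtDual_mk {v : Fin 23 → ZMod 2} (hv : hammingNorm v ≤ 3) :
    minWtDual (Submodule.Quotient.mk v) = hammingNorm v := by
  refine le_antisymm (Nat.sInf_le ⟨v, rfl, rfl⟩) (le_csInf ⟨_, v, rfl, rfl⟩ ?_)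
  rintro n ⟨u, hu, rfl⟩
  by_contra! h
  have := golaySyndrome_injOn (h.le.trans hv) hv (mk_golayDual_eq_iff.1 hu)
  exact h.ne (congrArg hammingNorm this)

theorem exists_mk_golayDual_eq (q : (Fin 23 → ZMod 2) ⧸ golayDual) :
    ∃ v : Fin 23 → ZMod 2, Submodule.Quotient.mk v = q ∧ hammingNorm v ≤ 3 := by
  obtain ⟨u, rfl⟩ := Submodule.Quotient.mk_surjective _ q
  obtain ⟨v, hv, h⟩ := exists_hammingNorm_le_three (golaySyndrome u)
  exact ⟨v, mk_golayDual_eq_iff.2 h, hv⟩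

theorem stmt_16 :
    (∀ q : (Fin 23 → ZMod 2) ⧸ golayDual,
      ∃! v : Fin 23 → ZMod 2,
        (Submodule.Quotient.mk v : (Fin 23 → ZMod 2) ⧸ golayDual) = q ∧ hammingNorm v ≤ 3) ∧
    (∀ w : Fin 4,
      Nat.card {q : (Fin 23 → ZMod 2) ⧸ golayDual // minWtDual q = (w : ℕ)} =
        Nat.choose 23 (w : ℕ)) ∧
    (∀ q : (Fin 23 → ZMod 2) ⧸ golayDual, minWtDual q ≤ 3) := by
  refine ⟨fun q => ?_, fun w => ?_, fun q => ?_⟩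
  · obtain ⟨v, rfl, hv⟩ := exists_mk_golayDual_eq q
    exact ⟨v, ⟨rfl, hv⟩, fun u hu =>
      golaySyndrome_injOn hu.2 hv (mk_golayDual_eq_iff.1 hu.1)⟩
  · have hw : (w : ℕ) ≤ 3 := Nat.le_of_lt_succ w.2
    have hcard := card_hammingNorm_eq (Fin 23) w
    rw [Fintype.card_fin, ← Fintype.card_subtype, ← Nat.card_eq_fintype_card] at hcard
    rw [← hcard]
    refine (Nat.card_eq_of_bijective (fun v : {v : Fin 23 → ZMod 2 // hammingNorm v = w} =>
      (⟨Submodule.Quotient.mk v.1, (minWtDual_mk (v.2.trans_le hw)).trans v.2⟩ :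
        {q : (Fin 23 → ZMod 2) ⧸ golayDual // minWtDual q = (w : ℕ)})) ⟨?_, ?_⟩).symm
    · intro u v h
      exact Subtype.ext (golaySyndrome_injOn (u.2.trans_le hw) (v.2.trans_le hw)
        (mk_golayDual_eq_iff.1 (congrArg Subtype.val h)))
    · rintro ⟨q, hq⟩
      obtain ⟨v, rfl, hv⟩ := exists_mk_golayDual_eq q
      exact ⟨⟨v, (minWtDual_mk hv).symm.trans hq⟩, rfl⟩
  · obtain ⟨v, rfl, hv⟩ := exists_mk_golayDual_eq q
    exact (minWtDual_mk hv).trans_le hv
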